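/- Let X be a compact Hausdorff space. The set MCX of convex capacities is a closed subset of the space MX of all upper-semicontinuous capacities on X. -/

import Mathlib

open Set MeasureTheory TopologicalSpace
open scoped NNReal

/-- An upper-semicontinuous normed capacity on a topological space `X`:
a `[0,1]`-valued monotone function on closed sets with `ν ∅ = 0`, `ν X = 1`,
satisfying the upper-semicontinuity condition. -/
structure Capacity (X : Type*) [TopologicalSpace X] where
  toFun : Set X → ℝ
  empty' : toFun ∅ = 0
  univ' : toFun Set.univ = 1
  mono' : ∀ F G : Set X, IsClosed F → IsClosed G → F ⊆ G → toFun F ≤ toFun G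
  usc' : ∀ (F : Set X) (a : ℝ), IsClosed F → toFun F < a →
    ∃ O : Set X, IsOpen O ∧ F ⊆ O ∧ ∀ B : Set X, IsCompact B → B ⊆ O → toFun B < a

namespace Capacity

variable {X : Type*} [TopologicalSpace X]

/-- The extension of a capacity to open sets: `ν(U) = sup{ν(K) : K closed, K ⊆ U}`. -/
noncomputable def opensVal (ν : Capacity X) (U : Set X) : ℝ :=
  sSup (ν.toFun '' {K : Set X | IsClosed K ∧ K ⊆ U})

/-- The topology on the space of capacities, generated by the subbase of sets
`O₋(F,a) = {c : c(F) < a}` for `F` closed and `O₊(U,a) = {c : c(U) > a}` for `U` open. -/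
instance : TopologicalSpace (Capacity X) :=
  TopologicalSpace.generateFrom
    ({S | ∃ (F : Set X) (a : ℝ), IsClosed F ∧ S = {c : Capacity X | c.toFun F < a}} ∪
     {S | ∃ (U : Set X) (a : ℝ), IsOpen U ∧ S = {c : Capacity X | a < c.opensVal U}})

/-- A capacity is convex (supermodular) if `ν(A∪B) + ν(A∩B) ≥ ν(A) + ν(B)` for closed `A,B`. -/
def IsConvexCap (ν : Capacity X) : Prop :=
  ∀ A B : Set X, IsClosed A → IsClosed B →
    ν.toFun A + ν.toFun B ≤ ν.toFun (A ∪ B) + ν.toFun (A ∩ B)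

/-- A capacity is balanced if `Σ λᵢ ν(Aᵢ) ≤ 1` whenever `λᵢ ≥ 0`, `Aᵢ` closed and
`Σ λᵢ χ_{Aᵢ} ≤ 1` pointwise. -/
def IsBalanced (ν : Capacity X) : Prop :=
  ∀ (n : ℕ) (lam : Fin n → ℝ) (A : Fin n → Set X),
    (∀ i, 0 ≤ lam i) → (∀ i, IsClosed (A i)) →
    (∀ x : X, ∑ i, lam i * (A i).indicator (fun _ => (1 : ℝ)) x ≤ 1) →
    ∑ i, lam i * ν.toFun (A i) ≤ 1

/-- A capacity is totally balanced if for every closed `B`, `Σ λᵢ ν(Aᵢ) ≤ ν(B)` whenever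
`λᵢ ≥ 0`, the `Aᵢ ⊆ B` are closed and `Σ λᵢ χ_{Aᵢ} ≤ 1` pointwise. -/
def IsTotallyBalanced (ν : Capacity X) : Prop :=
  ∀ B : Set X, IsClosed B →
    ∀ (n : ℕ) (lam : Fin n → ℝ) (A : Fin n → Set X),
      (∀ i, 0 ≤ lam i) → (∀ i, IsClosed (A i)) → (∀ i, A i ⊆ B) →
      (∀ x : X, ∑ i, lam i * (A i).indicator (fun _ => (1 : ℝ)) x ≤ 1) →
      ∑ i, lam i * ν.toFun (A i) ≤ ν.toFun B

variable [MeasurableSpace X] [BorelSpace X]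

/-- The core of a capacity: all regular Borel probability measures dominating it on closed sets. -/
def core (ν : Capacity X) : Set (ProbabilityMeasure X) :=
  {μ | μ.toMeasure.Regular ∧ ∀ A : Set X, IsClosed A → ν.toFun A ≤ ((μ A : ℝ≥0) : ℝ)}

/-- A capacity is exact if for every closed `B` some measure in its core attains `ν(B)` at `B`. -/
def IsExact (ν : Capacity X) : Prop :=
  ∀ B : Set X, IsClosed B → ∃ μ ∈ ν.core, ((μ B : ℝ≥0) : ℝ) = ν.toFun B

end Capacity

namespace Capacity

lemma toFun_le_opensVal {X : Type*} [TopologicalSpace X] (ν : Capacity X) {A U : Set X}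
    (hA : IsClosed A) (hAU : A ⊆ U) : ν.toFun A ≤ ν.opensVal U := by
  refine le_csSup ⟨1, ?_⟩ ⟨A, ⟨hA, hAU⟩, rfl⟩
  rintro _ ⟨K, ⟨hK, -⟩, rfl⟩
  exact ν.univ' ▸ ν.mono' K univ hK isClosed_univ (subset_univ K)

lemma opensVal_le_toFun {X : Type*} [TopologicalSpace X] (ν : Capacity X) {U F : Set X}
    (hF : IsClosed F) (hUF : U ⊆ F) : ν.opensVal U ≤ ν.toFun F := by
  refine csSup_le ⟨_, ∅, ⟨isClosed_empty, empty_subset U⟩, rfl⟩ ?_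
  rintro _ ⟨K, ⟨hK, hKU⟩, rfl⟩
  exact ν.mono' K F hK hF (hKU.trans hUF)

lemma isOpen_toFun_lt {X : Type*} [TopologicalSpace X] {F : Set X} (hF : IsClosed F) (a : ℝ) :
    IsOpen {c : Capacity X | c.toFun F < a} :=
  isOpen_generateFrom_of_mem (Or.inl ⟨F, a, hF, rfl⟩)

lemma isOpen_lt_opensVal {X : Type*} [TopologicalSpace X] {U : Set X} (hU : IsOpen U) (a : ℝ) :
    IsOpen {c : Capacity X | a < c.opensVal U} :=
  isOpen_generateFrom_of_mem (Or.inr ⟨U, a, hU, rfl⟩)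

end Capacity

/-- Closed sets in a normal space have open neighbourhoods whose closures have union and
intersection in prescribed neighbourhoods of the union and intersection. -/
lemma exists_isOpen_closure_union_inter_subset {X : Type*} [TopologicalSpace X] [NormalSpace X]
    {A B O P : Set X} (hA : IsClosed A) (hB : IsClosed B) (hO : IsOpen O) (hP : IsOpen P)
    (hABO : A ∪ B ⊆ O) (hABP : A ∩ B ⊆ P) :
    ∃ U V : Set X, IsOpen U ∧ IsOpen V ∧ A ⊆ U ∧ B ⊆ V ∧
      closure U ∪ closure V ⊆ O ∧ closure U ∩ closure V ⊆ P := by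
  obtain ⟨V, hV, hBV, hVs⟩ := normal_exists_closure_subset hB
    (hO.inter (hA.isOpen_compl.union hP)) fun x hx =>
      ⟨hABO (Or.inr hx), (em (x ∈ A)).elim (fun h => Or.inr (hABP ⟨h, hx⟩)) Or.inl⟩
  obtain ⟨U, hU, hAU, hUs⟩ := normal_exists_closure_subset hA
    (hO.inter (isClosed_closure (s := V).isOpen_compl.union hP)) fun x hx =>
      ⟨hABO (Or.inl hx), (em (x ∈ closure V)).elim
        (fun h => Or.inr ((hVs h).2.resolve_left fun h' => h' hx)) Or.inl⟩
  exact ⟨U, V, hU, hV, hAU, hBV,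
    union_subset (fun x hx => (hUs hx).1) (fun x hx => (hVs hx).1),
    fun x hx => (hUs hx.1).2.resolve_left fun h => h hx.2⟩

/-- The set of convex capacities is closed in `MX`. -/
theorem isClosed_convex_capacities (X : Type*) [TopologicalSpace X]
    [CompactSpace X] [T2Space X] :
    IsClosed {ν : Capacity X | ν.IsConvexCap} := by
  rw [← isOpen_compl_iff, isOpen_iff_mem_nhds]
  intro ν hν
  simp only [mem_compl_iff, mem_ofPred_eq, Capacity.IsConvexCap, not_forall, not_le] at hν
  obtain ⟨A, B, hA, hB, hlt⟩ := hν
  obtain ⟨ε, hε, hsum⟩ : ∃ ε > 0, ν.toFun (A ∪ B) + ν.toFun (A ∩ B) + 4 * ε =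
      ν.toFun A + ν.toFun B :=
    ⟨(ν.toFun A + ν.toFun B - (ν.toFun (A ∪ B) + ν.toFun (A ∩ B))) / 4, by linarith, by ring⟩
  obtain ⟨O, hO, hABO, hνO⟩ := ν.usc' (A ∪ B) (ν.toFun (A ∪ B) + ε) (hA.union hB) (by linarith)
  obtain ⟨P, hP, hABP, hνP⟩ := ν.usc' (A ∩ B) (ν.toFun (A ∩ B) + ε) (hA.inter hB) (by linarith)
  obtain ⟨U, V, hU, hV, hAU, hBV, hUVO, hUVP⟩ :=
    exists_isOpen_closure_union_inter_subset hA hB hO hP hABO hABP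
  have hcU : IsClosed (closure U) := isClosed_closure
  have hcV : IsClosed (closure V) := isClosed_closure
  have hνA := ν.toFun_le_opensVal hA hAU
  have hνB := ν.toFun_le_opensVal hB hBV
  filter_upwards [
    (Capacity.isOpen_toFun_lt (hcU.union hcV) _).mem_nhds (hνO _ (hcU.union hcV).isCompact hUVO),
    (Capacity.isOpen_toFun_lt (hcU.inter hcV) _).mem_nhds (hνP _ (hcU.inter hcV).isCompact hUVP),
    (Capacity.isOpen_lt_opensVal hU (ν.toFun A - ε)).mem_nhds
      (show ν.toFun A - ε < ν.opensVal U by linarith),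
    (Capacity.isOpen_lt_opensVal hV (ν.toFun B - ε)).mem_nhds
      (show ν.toFun B - ε < ν.opensVal V by linarith)] with c h₁ h₂ h₃ h₄ hc
  have hc' := hc _ _ hcU hcV
  have hU' := c.opensVal_le_toFun hcU subset_closure
  have hV' := c.opensVal_le_toFun hcV subset_closure
  linarith
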